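/- Let γ be a real number and for real θ with sinh(γ+θ) ≠ 0 define the 4×4 matrix R̂(θ) with rows (1,0,0,0), (0,x,y,0), (0,y,x,0), (0,0,0,1) where x = sinh γ / sinh(γ+θ) and y = sinh θ / sinh(γ+θ). Then for all real θ, θ′ such that sinh(γ+θ) ≠ 0, sinh(γ+θ′) ≠ 0 and sinh(γ+θ+θ′) ≠ 0, the Baxterized braid equation holds: R̂₁₂(θ)·R̂₂₃(θ+θ′)·R̂₁₂(θ′) = R̂₂₃(θ′)·R̂₁₂(θ+θ′)·R̂₂₃(θ). -/

import Mathlib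

open Matrix Kronecker

/-- Order-preserving encoding of `Fin 2 × Fin 2` into `Fin 4`, corresponding to the
basis order `e₁⊗e₁, e₁⊗e₂, e₂⊗e₁, e₂⊗e₂`. -/
noncomputable def enc4 : Fin 2 × Fin 2 → Fin 4 := fun p => ![![0, 1], ![2, 3]] p.1 p.2

/-- View a `4×4` matrix as a matrix on the tensor square. -/
noncomputable def toT (A : Matrix (Fin 4) (Fin 4) ℝ) :
    Matrix (Fin 2 × Fin 2) (Fin 2 × Fin 2) ℝ := A.submatrix enc4 enc4

/-- `A₁₂ = A ⊗ I₂`. -/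
noncomputable def op12 (A : Matrix (Fin 4) (Fin 4) ℝ) :
    Matrix (Fin 2 × Fin 2 × Fin 2) (Fin 2 × Fin 2 × Fin 2) ℝ :=
  Matrix.reindex (Equiv.prodAssoc (Fin 2) (Fin 2) (Fin 2))
    (Equiv.prodAssoc (Fin 2) (Fin 2) (Fin 2))
    (toT A ⊗ₖ (1 : Matrix (Fin 2) (Fin 2) ℝ))

/-- `A₂₃ = I₂ ⊗ A`. -/
noncomputable def op23 (A : Matrix (Fin 4) (Fin 4) ℝ) :
    Matrix (Fin 2 × Fin 2 × Fin 2) (Fin 2 × Fin 2 × Fin 2) ℝ :=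
  (1 : Matrix (Fin 2) (Fin 2) ℝ) ⊗ₖ toT A

/-- The 6-vertex braid matrix in the trigonometric parametrization, with
`x = sinh γ / sinh(γ+θ)`, `y = sinh θ / sinh(γ+θ)`. -/
noncomputable def R6 (γ θ : ℝ) : Matrix (Fin 4) (Fin 4) ℝ :=
  !![1, 0, 0, 0;
     0, Real.sinh γ / Real.sinh (γ + θ), Real.sinh θ / Real.sinh (γ + θ), 0;
     0, Real.sinh θ / Real.sinh (γ + θ), Real.sinh γ / Real.sinh (γ + θ), 0;
     0, 0, 0, 1]

set_option maxHeartbeats 8000000 in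
/-- the Baxterized braid equation for the 6-vertex braid matrix with
additive spectral parameter. -/
theorem sixvertex_braid_equation (γ θ θ' : ℝ)
    (h1 : Real.sinh (γ + θ) ≠ 0)
    (h2 : Real.sinh (γ + θ') ≠ 0)
    (h3 : Real.sinh (γ + (θ + θ')) ≠ 0) :
    op12 (R6 γ θ) * op23 (R6 γ (θ + θ')) * op12 (R6 γ θ') =
      op23 (R6 γ θ') * op12 (R6 γ (θ + θ')) * op23 (R6 γ θ) := by
  have e3 : Real.sinh (γ + (θ + θ')) ≠ 0 := h3
  obtain ⟨X, hX⟩ : ∃ X, X = Real.sinh γ / Real.sinh (γ + θ) := ⟨_, rfl⟩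
  obtain ⟨Y, hY⟩ : ∃ Y, Y = Real.sinh θ / Real.sinh (γ + θ) := ⟨_, rfl⟩
  obtain ⟨X', hX'⟩ : ∃ X, X = Real.sinh γ / Real.sinh (γ + θ') := ⟨_, rfl⟩
  obtain ⟨Y', hY'⟩ : ∃ Y, Y = Real.sinh θ' / Real.sinh (γ + θ') := ⟨_, rfl⟩
  obtain ⟨Z, hZ⟩ : ∃ X, X = Real.sinh γ / Real.sinh (γ + (θ + θ')) := ⟨_, rfl⟩
  obtain ⟨W, hW⟩ : ∃ X, X = Real.sinh (θ + θ') / Real.sinh (γ + (θ + θ')) := ⟨_, rfl⟩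
  have c1 := Real.cosh_sq γ
  have c2 := Real.cosh_sq θ
  have c3 := Real.cosh_sq θ'
  have i1 : X * X' + Y * Z * Y' = Z := by
    rw [hX, hX', hY, hY', hZ]
    field_simp
    simp only [Real.sinh_add, Real.cosh_add]
    grind
  have i2 : X * Y' + Y * Z * X' = W * X := by
    rw [hX, hX', hY, hY', hZ, hW]
    field_simp
    simp only [Real.sinh_add, Real.cosh_add]
    grind
  have i3 : Y * X' + X * Z * Y' = W * X' := by
    rw [hX, hX', hY, hY', hZ, hW]
    field_simp
    simp only [Real.sinh_add, Real.cosh_add]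
    grind
  unfold R6
  rw [← hX, ← hY, ← hX', ← hY', ← hZ, ← hW]
  clear hX hY hX' hY' hZ hW
  ext ⟨a, b, c⟩ ⟨d, e, f⟩
  fin_cases a <;> fin_cases b <;> fin_cases c <;> fin_cases d <;> fin_cases e <;> fin_cases f <;>
    simp [op12, op23, toT, enc4, Matrix.mul_apply, Fintype.sum_prod_type, Matrix.one_apply] <;>
    grind
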